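/- arXiv:1506.01604 — 2 statements merged into one kernel-verified Lean document; each statement's English description precedes it below -/
import Mathlib

section
/- In ℚ[SL₂(F)], set e = (1/(2(q−1)))·(A−B) and f = (1/(2(q−1)))·(A+B). Then e and f are idempotents (e·e = e and f·f = f), they are orthogonal (e·f = f·e = 0), and they satisfy the eigenvalue relations B·e = (1−q)·e and B·f = (q−1)·f for left-multiplication by B. -/
open MonoidAlgebra

/-- Sum of all elements of `SL₂(F)` whose support pattern is given by the four
Booleans (`true` = the entry is nonzero, `false` = the entry is zero). -/
noncomputable def suppClass (R : Type*) [CommRing R] (F : Type*) [Field F] [Fintype F]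
    [DecidableEq F] (b₁₁ b₁₂ b₂₁ b₂₂ : Bool) :
    MonoidAlgebra R (Matrix.SpecialLinearGroup (Fin 2) F) :=
  ∑ g ∈ Finset.univ.filter
      (fun g : Matrix.SpecialLinearGroup (Fin 2) F =>
        (b₁₁ = true ↔ (g : Matrix (Fin 2) (Fin 2) F) 0 0 ≠ 0) ∧
        (b₁₂ = true ↔ (g : Matrix (Fin 2) (Fin 2) F) 0 1 ≠ 0) ∧
        (b₂₁ = true ↔ (g : Matrix (Fin 2) (Fin 2) F) 1 0 ≠ 0) ∧
        (b₂₂ = true ↔ (g : Matrix (Fin 2) (Fin 2) F) 1 1 ≠ 0)),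
    MonoidAlgebra.of R (Matrix.SpecialLinearGroup (Fin 2) F) g

/-- The support class `A` (diagonal matrices). -/
noncomputable def elA (R : Type*) [CommRing R] (F : Type*) [Field F] [Fintype F] [DecidableEq F] :=
  suppClass R F true false false true
/-- The support class `B` (antidiagonal matrices). -/
noncomputable def elB (R : Type*) [CommRing R] (F : Type*) [Field F] [Fintype F] [DecidableEq F] :=
  suppClass R F false true true false
/-- The support class `C` (matrices with all entries nonzero). -/
noncomputable def elC (R : Type*) [CommRing R] (F : Type*) [Field F] [Fintype F] [DecidableEq F] :=
  suppClass R F true true true true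
/-- The support class `D₊` (upper triangular with nonzero entries). -/
noncomputable def elDp (R : Type*) [CommRing R] (F : Type*) [Field F] [Fintype F] [DecidableEq F] :=
  suppClass R F true true false true
/-- The support class `D₋` (lower triangular with nonzero entries). -/
noncomputable def elDm (R : Type*) [CommRing R] (F : Type*) [Field F] [Fintype F] [DecidableEq F] :=
  suppClass R F true false true true
/-- The support class `E₊`. -/
noncomputable def elEp (R : Type*) [CommRing R] (F : Type*) [Field F] [Fintype F] [DecidableEq F] :=
  suppClass R F true true true false
/-- The support class `E₋`. -/
noncomputable def elEm (R : Type*) [CommRing R] (F : Type*) [Field F] [Fintype F] [DecidableEq F] :=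
  suppClass R F false true true true

open Matrix in
/-- Diagonal elements. -/
def dgl {F : Type*} [Field F] (u : Fˣ) : Matrix.SpecialLinearGroup (Fin 2) F :=
  ⟨!![(u : F), 0; 0, ((u⁻¹ : Fˣ) : F)], by simp [Matrix.det_fin_two]⟩

open Matrix in
/-- Antidiagonal elements. -/
def adg {F : Type*} [Field F] (u : Fˣ) : Matrix.SpecialLinearGroup (Fin 2) F :=
  ⟨!![0, (u : F); -((u⁻¹ : Fˣ) : F), 0], by simp [Matrix.det_fin_two]⟩

theorem dd {F : Type*} [Field F] (u v : Fˣ) : dgl u * dgl v = dgl (u * v) := by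
  ext i j
  rw [Matrix.SpecialLinearGroup.coe_mul]
  fin_cases i <;> fin_cases j <;> simp [dgl, Matrix.mul_apply, Fin.sum_univ_two, mul_comm]

theorem da {F : Type*} [Field F] (u v : Fˣ) : dgl u * adg v = adg (u * v) := by
  ext i j
  rw [Matrix.SpecialLinearGroup.coe_mul]
  fin_cases i <;> fin_cases j <;> simp [dgl, adg, Matrix.mul_apply, Fin.sum_univ_two, mul_comm]

theorem ad {F : Type*} [Field F] (u v : Fˣ) : adg u * dgl v = adg (u * v⁻¹) := by
  ext i j
  rw [Matrix.SpecialLinearGroup.coe_mul]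
  fin_cases i <;> fin_cases j <;> simp [dgl, adg, Matrix.mul_apply, Fin.sum_univ_two, mul_comm]

theorem aa {F : Type*} [Field F] (u v : Fˣ) : adg u * adg v = dgl (-u * v⁻¹) := by
  ext i j
  rw [Matrix.SpecialLinearGroup.coe_mul]
  fin_cases i <;> fin_cases j <;>
    simp [dgl, adg, Matrix.mul_apply, Fin.sum_univ_two, mul_comm, inv_neg]

theorem elA_eq (F : Type*) [Field F] [Fintype F] [DecidableEq F] :
    elA ℚ F = ∑ u : Fˣ, MonoidAlgebra.of ℚ _ (dgl u) := by
  unfold elA suppClass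
  symm
  refine Finset.sum_bij (fun u _ => dgl u) ?_ ?_ ?_ ?_
  · intro u _
    refine Finset.mem_filter.2 ⟨Finset.mem_univ _, ?_⟩
    simp [dgl]
  · intro u _ v _ h
    have := congrArg (fun g : Matrix.SpecialLinearGroup (Fin 2) F => g.1 0 0) h
    exact Units.ext (by simpa [dgl] using this)
  · intro g hg
    simp only [Finset.mem_filter, Finset.mem_univ, true_and, true_iff, Bool.false_eq_true,
      false_iff, not_not] at hg
    obtain ⟨h1, h2, h3, h4⟩ := hg
    have hd := g.2
    rw [Matrix.det_fin_two] at hd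
    refine ⟨Units.mk0 _ h1, Finset.mem_univ _, ?_⟩
    have h5 : (g.1 0 0)⁻¹ = g.1 1 1 := by
      rw [h2] at hd
      exact inv_eq_of_mul_eq_one_right (by simpa using hd)
    ext i j
    fin_cases i <;> fin_cases j <;> simp [dgl, h2, h3, h5]
  · intro u _
    rfl

theorem elB_eq (F : Type*) [Field F] [Fintype F] [DecidableEq F] :
    elB ℚ F = ∑ u : Fˣ, MonoidAlgebra.of ℚ _ (adg u) := by
  unfold elB suppClass
  symm
  refine Finset.sum_bij (fun u _ => adg u) ?_ ?_ ?_ ?_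
  · intro u _
    refine Finset.mem_filter.2 ⟨Finset.mem_univ _, ?_⟩
    simp [adg]
  · intro u _ v _ h
    have := congrArg (fun g : Matrix.SpecialLinearGroup (Fin 2) F => g.1 0 1) h
    exact Units.ext (by simpa [adg] using this)
  · intro g hg
    simp only [Finset.mem_filter, Finset.mem_univ, true_and, true_iff, Bool.false_eq_true,
      false_iff, not_not] at hg
    obtain ⟨h1, h2, h3, h4⟩ := hg
    have hd := g.2
    rw [Matrix.det_fin_two] at hd
    refine ⟨Units.mk0 _ h2, Finset.mem_univ _, ?_⟩
    have h5 : (g.1 0 1)⁻¹ = - g.1 1 0 := by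
      rw [h1] at hd
      exact inv_eq_of_mul_eq_one_right (by simpa using hd)
    ext i j
    fin_cases i <;> fin_cases j <;> simp [adg, h1, h4, h5]
  · intro u _
    rfl

theorem sum_mul_aux {U G : Type*} [Fintype U] [Monoid G] (x y z : U → G)
    (s : U → U ≃ U) (h : ∀ u v, x u * y v = z (s u v)) :
    (∑ u, MonoidAlgebra.of ℚ G (x u)) * (∑ u, MonoidAlgebra.of ℚ G (y u)) =
      (Fintype.card U : ℚ) • ∑ u, MonoidAlgebra.of ℚ G (z u) := by
  rw [Finset.sum_mul]
  have : ∀ u, MonoidAlgebra.of ℚ G (x u) * (∑ v, MonoidAlgebra.of ℚ G (y v)) =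
      ∑ v, MonoidAlgebra.of ℚ G (z v) := by
    intro u
    rw [Finset.mul_sum, ← Equiv.sum_comp (s u) (fun v => MonoidAlgebra.of ℚ G (z v))]
    exact Finset.sum_congr rfl fun v _ => by rw [← map_mul, h]
  rw [Finset.sum_congr rfl fun u _ => this u, Finset.sum_const, Finset.card_univ,
    Nat.cast_smul_eq_nsmul]

theorem ef_idempotents (F : Type*) [Field F] [Fintype F] [DecidableEq F]
    (hq : 2 < Fintype.card F) (q : ℚ) (hqc : q = Fintype.card F)
    (e f : MonoidAlgebra ℚ (Matrix.SpecialLinearGroup (Fin 2) F))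
    (he : e = (2 * (q - 1))⁻¹ • (elA ℚ F - elB ℚ F))
    (hf : f = (2 * (q - 1))⁻¹ • (elA ℚ F + elB ℚ F)) :
    e * e = e ∧ f * f = f ∧ e * f = 0 ∧ f * e = 0 ∧
    elB ℚ F * e = (1 - q) • e ∧ elB ℚ F * f = (q - 1) • f := by
  have hc : (Fintype.card Fˣ : ℚ) = q - 1 := by
    rw [Fintype.card_units, hqc, Nat.cast_sub (by omega), Nat.cast_one]
  have hq1 : q - 1 ≠ 0 := by
    rw [← hc]
    exact_mod_cast Fintype.card_ne_zero
  have hAA : elA ℚ F * elA ℚ F = (q - 1) • elA ℚ F := by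
    rw [elA_eq, ← hc]
    exact sum_mul_aux _ _ _ (fun u => Equiv.mulLeft u) dd
  have hAB : elA ℚ F * elB ℚ F = (q - 1) • elB ℚ F := by
    rw [elA_eq, elB_eq, ← hc]
    exact sum_mul_aux _ _ _ (fun u => Equiv.mulLeft u) da
  have hBA : elB ℚ F * elA ℚ F = (q - 1) • elB ℚ F := by
    rw [elA_eq, elB_eq, ← hc]
    exact sum_mul_aux _ _ _ (fun u => (Equiv.inv Fˣ).trans (Equiv.mulLeft u)) ad
  have hBB : elB ℚ F * elB ℚ F = (q - 1) • elA ℚ F := by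
    rw [elA_eq, elB_eq, ← hc]
    exact sum_mul_aux _ _ _ (fun u => (Equiv.inv Fˣ).trans (Equiv.mulLeft (-u))) aa
  subst he hf
  refine ⟨?_, ?_, ?_, ?_, ?_, ?_⟩ <;>
    simp only [smul_mul_assoc, mul_smul_comm, mul_add, add_mul, mul_sub, sub_mul,
      hAA, hAB, hBA, hBB] <;>
    match_scalars <;> field_simp <;> ring
end

section
/- In ℤ[SL₂(F)], the five elements A, B, C, D₊+D₋, E₊+E₋ pairwise commute, and with I = A+B, D = D₊+D₋, E = E₊+E₋, F' = D+E the following product formulas hold: C·F' = F'·C = 4(q−1)(q−3)·C + 2(q−1)(q−2)·F' and F'² = 4(q−1)²·I + 8(q−1)·C + 2(q−1)²·F'. Hence the ℤ-span of I, C, F' is a commutative ring. -/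
open MonoidAlgebra

namespace ICFproof
open Matrix

variable {F : Type*} [Field F] [Fintype F] [DecidableEq F]

local notation "SLF" => Matrix.SpecialLinearGroup (Fin 2) F
local notation "ZG" => MonoidAlgebra ℤ (Matrix.SpecialLinearGroup (Fin 2) F)

def wEl (F : Type*) [Field F] : Matrix.SpecialLinearGroup (Fin 2) F :=
  ⟨!![0, 1; -1, 0], by simp [Matrix.det_fin_two]⟩
def hEl (t : Fˣ) : SLF := ⟨!![(t : F), 0; 0, (t⁻¹ : Fˣ)], by simp [Matrix.det_fin_two]⟩
def xEl (s : F) : SLF := ⟨!![1, s; 0, 1], by simp [Matrix.det_fin_two]⟩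
def yEl (s : F) : SLF := ⟨!![1, 0; s, 1], by simp [Matrix.det_fin_two]⟩

@[simp] theorem coe_wEl : (wEl F : Matrix (Fin 2) (Fin 2) F) = !![0, 1; -1, 0] := rfl
@[simp] theorem coe_hEl (t : Fˣ) :
    (hEl t : Matrix (Fin 2) (Fin 2) F) = !![(t : F), 0; 0, (t⁻¹ : Fˣ)] := rfl
@[simp] theorem coe_xEl (s : F) : (xEl s : Matrix (Fin 2) (Fin 2) F) = !![1, s; 0, 1] := rfl
@[simp] theorem coe_yEl (s : F) : (yEl s : Matrix (Fin 2) (Fin 2) F) = !![1, 0; s, 1] := rfl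

noncomputable def w (F : Type*) [Field F] :
    MonoidAlgebra ℤ (Matrix.SpecialLinearGroup (Fin 2) F) := of ℤ _ (wEl F)
noncomputable def S (F : Type*) [Field F] [Fintype F] [DecidableEq F] :
    MonoidAlgebra ℤ (Matrix.SpecialLinearGroup (Fin 2) F) := ∑ g, of ℤ _ g
noncomputable def u (F : Type*) [Field F] [Fintype F] [DecidableEq F] :
    MonoidAlgebra ℤ (Matrix.SpecialLinearGroup (Fin 2) F) := ∑ s : Fˣ, of ℤ _ (xEl (s : F))
noncomputable def v (F : Type*) [Field F] [Fintype F] [DecidableEq F] :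
    MonoidAlgebra ℤ (Matrix.SpecialLinearGroup (Fin 2) F) := ∑ s : Fˣ, of ℤ _ (yEl (s : F))

theorem w_mul (a b c d : Bool) : w F * suppClass ℤ F a b c d = suppClass ℤ F c d a b := by
  unfold w suppClass
  rw [Finset.mul_sum]
  refine Finset.sum_bij' (fun g _ => wEl F * g) (fun g _ => (wEl F)⁻¹ * g) ?_ ?_ ?_ ?_ ?_
  · intro g hg
    simp [Matrix.SpecialLinearGroup.coe_mul, Matrix.SpecialLinearGroup.coe_inv, Fin.sum_univ_two, Matrix.mul_apply] at hg ⊢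
    tauto
  · intro g hg
    simp [Matrix.SpecialLinearGroup.coe_mul, Matrix.SpecialLinearGroup.coe_inv, Fin.sum_univ_two, Matrix.adjugate_fin_two, Matrix.mul_apply] at hg ⊢
    tauto
  · simp
  · simp
  · intro g hg
    rw [map_mul]

theorem mul_w (a b c d : Bool) : suppClass ℤ F a b c d * w F = suppClass ℤ F b a d c := by
  unfold w suppClass
  rw [Finset.sum_mul]
  refine Finset.sum_bij' (fun g _ => g * wEl F) (fun g _ => g * (wEl F)⁻¹) ?_ ?_ ?_ ?_ ?_
  · intro g hg
    simp [Matrix.SpecialLinearGroup.coe_mul, Matrix.SpecialLinearGroup.coe_inv, Fin.sum_univ_two, Matrix.mul_apply] at hg ⊢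
    tauto
  · intro g hg
    simp [Matrix.SpecialLinearGroup.coe_mul, Matrix.SpecialLinearGroup.coe_inv, Fin.sum_univ_two, Matrix.adjugate_fin_two, Matrix.mul_apply] at hg ⊢
    tauto
  · simp
  · simp
  · intro g hg
    rw [map_mul]

theorem S_mul_of (g : SLF) : S F * of ℤ _ g = S F := by
  unfold S
  rw [Finset.sum_mul]
  refine Fintype.sum_equiv (Equiv.mulRight g) _ _ fun x => ?_
  rw [← map_mul]; rfl

theorem of_mul_S (g : SLF) : of ℤ _ g * S F = S F := by
  unfold S
  rw [Finset.mul_sum]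
  refine Fintype.sum_equiv (Equiv.mulLeft g) _ _ fun x => ?_
  rw [← map_mul]; rfl

theorem S_comm (x : ZG) : S F * x = x * S F := by
  induction x using MonoidAlgebra.induction_on with
  | of g => rw [S_mul_of, of_mul_S]
  | add a b ha hb => rw [mul_add, add_mul, ha, hb]
  | smul r a ha => rw [mul_smul_comm, smul_mul_assoc, ha]

theorem elA_eq : elA ℤ F = ∑ t : Fˣ, of ℤ _ (hEl t) := by
  unfold elA suppClass
  symm
  refine Finset.sum_bij (fun t _ => hEl t) ?_ ?_ ?_ ?_
  · intro t _
    simp [Matrix.SpecialLinearGroup.coe_mul, Matrix.SpecialLinearGroup.coe_inv, Matrix.mul_apply]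
  · intro t _ t' _ h
    have := congrArg (fun g : SLF => g 0 0) h
    simpa [Units.ext_iff] using this
  · intro g hg
    simp at hg
    obtain ⟨h1, h2, h3, h4⟩ := hg
    refine ⟨Units.mk0 _ h1, Finset.mem_univ _, ?_⟩
    have hd := g.det_coe
    rw [Matrix.det_fin_two] at hd
    ext i j
    fin_cases i <;> fin_cases j <;> simp [Matrix.SpecialLinearGroup.coe_mul, Matrix.SpecialLinearGroup.coe_inv, h2, h3, Matrix.mul_apply]
    rw [h2] at hd
    field_simp
    linear_combination -hd
  · intro _ _; rfl

theorem elDp_eq : elDp ℤ F = elA ℤ F * u F := by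
  rw [elA_eq, u, Finset.sum_mul_sum, ← Finset.sum_product']
  unfold elDp suppClass
  symm
  refine Finset.sum_bij (fun p _ => hEl p.1 * xEl (p.2 : F)) ?_ ?_ ?_ ?_
  · intro t _
    simp [Matrix.SpecialLinearGroup.coe_mul, Matrix.SpecialLinearGroup.coe_inv, Matrix.mul_apply]
  · rintro ⟨t, s⟩ _ ⟨t', s'⟩ _ h
    have h1 := congrArg (fun g : SLF => g 0 0) h
    have h2 := congrArg (fun g : SLF => g 0 1) h
    simp [Matrix.SpecialLinearGroup.coe_mul, Matrix.SpecialLinearGroup.coe_inv, Matrix.mul_apply] at h1 h2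
    obtain rfl := Units.ext h1
    simpa [Units.ext_iff] using h2
  · intro g hg
    simp at hg
    obtain ⟨h1, h2, h3, h4⟩ := hg
    have hd := g.det_coe
    rw [Matrix.det_fin_two] at hd
    refine ⟨⟨Units.mk0 _ h1, Units.mk0 (g 0 1 / g 0 0) (div_ne_zero h2 h1)⟩, by simp, ?_⟩
    ext i j
    fin_cases i <;> fin_cases j <;> simp [Matrix.SpecialLinearGroup.coe_mul, Matrix.SpecialLinearGroup.coe_inv, h3, Matrix.mul_apply]
    · field_simp
    · rw [h3] at hd
      field_simp
      linear_combination -hd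
  · intro _ _; rw [map_mul]

theorem elDp_eq' : elDp ℤ F = u F * elA ℤ F := by
  rw [elA_eq, u, Finset.sum_mul_sum, ← Finset.sum_product']
  unfold elDp suppClass
  symm
  refine Finset.sum_bij (fun p _ => xEl (p.1 : F) * hEl p.2) ?_ ?_ ?_ ?_
  · intro t _
    simp [Matrix.SpecialLinearGroup.coe_mul, Matrix.SpecialLinearGroup.coe_inv, Matrix.mul_apply]
  · rintro ⟨t, s⟩ _ ⟨t', s'⟩ _ h
    have h1 := congrArg (fun g : SLF => g 0 0) h
    have h2 := congrArg (fun g : SLF => g 0 1) h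
    simp [Matrix.SpecialLinearGroup.coe_mul, Matrix.SpecialLinearGroup.coe_inv, Matrix.mul_apply] at h1 h2
    obtain rfl := Units.ext h1
    simpa [Units.ext_iff] using h2
  · intro g hg
    simp at hg
    obtain ⟨h1, h2, h3, h4⟩ := hg
    have hd := g.det_coe
    rw [Matrix.det_fin_two] at hd
    refine ⟨⟨Units.mk0 (g 0 1 * g 0 0) (mul_ne_zero h2 h1), Units.mk0 _ h1⟩, by simp, ?_⟩
    ext i j
    fin_cases i <;> fin_cases j <;> simp [Matrix.SpecialLinearGroup.coe_mul, Matrix.SpecialLinearGroup.coe_inv, h3, Matrix.mul_apply]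
    · field_simp
    · rw [h3] at hd
      field_simp
      linear_combination -hd
  · intro _ _; rw [map_mul]

theorem elDm_eq : elDm ℤ F = elA ℤ F * v F := by
  rw [elA_eq, v, Finset.sum_mul_sum, ← Finset.sum_product']
  unfold elDm suppClass
  symm
  refine Finset.sum_bij (fun p _ => hEl p.1 * yEl (p.2 : F)) ?_ ?_ ?_ ?_
  · intro t _
    simp [Matrix.SpecialLinearGroup.coe_mul, Matrix.SpecialLinearGroup.coe_inv, Matrix.mul_apply]
  · rintro ⟨t, s⟩ _ ⟨t', s'⟩ _ h
    have h1 := congrArg (fun g : SLF => g 0 0) h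
    have h2 := congrArg (fun g : SLF => g 1 0) h
    simp [Matrix.SpecialLinearGroup.coe_mul, Matrix.SpecialLinearGroup.coe_inv, Matrix.mul_apply] at h1 h2
    obtain rfl := Units.ext h1
    simpa [Units.ext_iff] using h2
  · intro g hg
    simp at hg
    obtain ⟨h1, h2, h3, h4⟩ := hg
    have hd := g.det_coe
    rw [Matrix.det_fin_two] at hd
    refine ⟨⟨Units.mk0 _ h1, Units.mk0 (g 1 0 * g 0 0) (mul_ne_zero h3 h1)⟩, by simp, ?_⟩
    ext i j
    fin_cases i <;> fin_cases j <;> simp [Matrix.SpecialLinearGroup.coe_mul, Matrix.SpecialLinearGroup.coe_inv, h2, Matrix.mul_apply]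
    · field_simp
    · rw [h2] at hd
      field_simp
      linear_combination -hd
  · intro _ _; rw [map_mul]

theorem A_u_v : elA ℤ F * u F * v F = elC ℤ F + elEm ℤ F := by
  have e : elC ℤ F + elEm ℤ F = ∑ g ∈ Finset.univ.filter
      (fun g : SLF => g 0 1 ≠ 0 ∧ g 1 0 ≠ 0 ∧ g 1 1 ≠ 0), of ℤ _ g := by
    unfold elC elEm suppClass
    simp only [Finset.sum_filter]
    rw [← Finset.sum_add_distrib]
    refine Finset.sum_congr rfl fun g _ => ?_
    by_cases h1 : g 0 0 = 0 <;> by_cases h2 : g 0 1 = 0 <;> by_cases h3 : g 1 0 = 0 <;>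
      by_cases h4 : g 1 1 = 0 <;> simp [h1, h2, h3, h4]
  rw [e, elA_eq, u, v, Finset.sum_mul_sum, ← Finset.sum_product', Finset.sum_mul_sum,
    ← Finset.sum_product']
  refine Finset.sum_bij (fun p _ => hEl p.1.1 * xEl (p.1.2 : F) * yEl (p.2 : F)) ?_ ?_ ?_ ?_
  · intro t _
    simp [Matrix.SpecialLinearGroup.coe_mul, Matrix.SpecialLinearGroup.coe_inv, Matrix.mul_apply]
  · rintro ⟨⟨t, s⟩, r⟩ _ ⟨⟨t', s'⟩, r'⟩ _ h
    have h1 := congrArg (fun g : SLF => g 1 1) h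
    have h2 := congrArg (fun g : SLF => g 1 0) h
    have h3 := congrArg (fun g : SLF => g 0 1) h
    simp [Matrix.SpecialLinearGroup.coe_mul, Matrix.SpecialLinearGroup.coe_inv, Matrix.mul_apply] at h1 h2 h3
    obtain rfl := Units.ext h1
    simp at h2 h3
    simp [Units.ext_iff, h2, h3]
  · intro g hg
    simp at hg
    obtain ⟨h2, h3, h4⟩ := hg
    have hd := g.det_coe
    rw [Matrix.det_fin_two] at hd
    refine ⟨⟨⟨(Units.mk0 _ h4)⁻¹, Units.mk0 (g 0 1 * g 1 1) (mul_ne_zero h2 h4)⟩,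
      Units.mk0 (g 1 0 / g 1 1) (div_ne_zero h3 h4)⟩, by simp, ?_⟩
    ext i j
    fin_cases i <;> fin_cases j <;> simp [Matrix.SpecialLinearGroup.coe_mul, Matrix.SpecialLinearGroup.coe_inv, Matrix.mul_apply]
    · field_simp
      linear_combination -hd
    · field_simp
    · field_simp
  · intro _ _; rw [map_mul, map_mul]

theorem S_eq : S F = elA ℤ F + elB ℤ F + elC ℤ F + elDp ℤ F + elDm ℤ F + elEp ℤ F + elEm ℤ F := by
  unfold S elA elB elC elDp elDm elEp elEm suppClass
  simp only [Finset.sum_filter, ← Finset.sum_add_distrib]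
  refine Finset.sum_congr rfl fun g _ => ?_
  have hd := g.det_coe
  rw [Matrix.det_fin_two] at hd
  by_cases h1 : g 0 0 = 0 <;> by_cases h2 : g 0 1 = 0 <;> by_cases h3 : g 1 0 = 0 <;>
    by_cases h4 : g 1 1 = 0 <;> simp [h1, h2, h3, h4] at hd ⊢

theorem card_units_int : (Fintype.card Fˣ : ℤ) = Fintype.card F - 1 := by
  rw [Fintype.card_units, Nat.cast_sub Fintype.card_pos]; simp

theorem S_A : S F * elA ℤ F = ((Fintype.card F : ℤ) - 1) • S F := by
  rw [elA_eq, Finset.mul_sum]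
  simp only [S_mul_of, Finset.sum_const, Finset.card_univ, ← card_units_int, natCast_zsmul]

theorem S_u : S F * u F = ((Fintype.card F : ℤ) - 1) • S F := by
  rw [u, Finset.mul_sum]
  simp only [S_mul_of, Finset.sum_const, Finset.card_univ, ← card_units_int, natCast_zsmul]

theorem S_w : S F * w F = S F := S_mul_of _

theorem A_A : elA ℤ F * elA ℤ F = ((Fintype.card F : ℤ) - 1) • elA ℤ F := by
  rw [elA_eq, Finset.sum_mul_sum]
  have : ∀ t : Fˣ, ∑ t' : Fˣ, of ℤ SLF (hEl t) * of ℤ SLF (hEl t') = ∑ t : Fˣ, of ℤ SLF (hEl t) := by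
    intro t
    refine Fintype.sum_equiv (Equiv.mulLeft t) _ _ fun x => ?_
    rw [← map_mul]
    congr 1
    ext i j
    fin_cases i <;> fin_cases j <;> simp [Matrix.SpecialLinearGroup.coe_mul, Matrix.SpecialLinearGroup.coe_inv, mul_comm, Matrix.mul_apply]
  simp only [this, Finset.sum_const, Finset.card_univ, ← card_units_int, natCast_zsmul]

theorem u_eq : ∑ s : F, of ℤ SLF (xEl s) = 1 + u F := by
  have h0 : xEl (0 : F) = 1 := by
    ext i j
    fin_cases i <;> fin_cases j <;> simp [Matrix.SpecialLinearGroup.coe_mul, Matrix.SpecialLinearGroup.coe_inv, Matrix.mul_apply]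
  rw [← Finset.add_sum_erase _ _ (Finset.mem_univ (0 : F)), h0, map_one, u]
  congr 1
  symm
  refine Finset.sum_bij (fun s _ => (s : F)) ?_ ?_ ?_ ?_
  · simp
  · intro a _ b _ h; exact Units.ext h
  · intro b hb
    exact ⟨Units.mk0 b (by simpa using hb), by simp, rfl⟩
  · simp

theorem u_u' : (1 + u F) * (1 + u F) = (Fintype.card F : ℤ) • (1 + u F) := by
  rw [← u_eq, Finset.sum_mul_sum]
  have : ∀ t : F, ∑ t' : F, of ℤ SLF (xEl t) * of ℤ SLF (xEl t') = ∑ t : F, of ℤ SLF (xEl t) := by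
    intro t
    refine Fintype.sum_equiv (Equiv.addLeft t) _ _ fun x => ?_
    rw [← map_mul]
    congr 1
    ext i j
    fin_cases i <;> fin_cases j <;> simp [Matrix.SpecialLinearGroup.coe_mul, Matrix.SpecialLinearGroup.coe_inv, add_comm, Matrix.mul_apply]
  simp only [this, Finset.sum_const, Finset.card_univ, natCast_zsmul]

local notation "qq" => (Fintype.card F : ℤ)

theorem u_u : u F * u F = (qq - 1) • 1 + (qq - 2) • u F := by
  have h := u_u' (F := F)
  rw [mul_add, add_mul, add_mul, one_mul, one_mul, mul_one] at h
  have : u F * u F = (1 + u F + (u F + u F * u F)) - 1 - 2 • u F := by module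
  rw [this, h]
  module

theorem A_w : elA ℤ F * w F = elB ℤ F := mul_w ..
theorem w_A : w F * elA ℤ F = elB ℤ F := w_mul ..
theorem B_w : elB ℤ F * w F = elA ℤ F := mul_w ..
theorem C_w : elC ℤ F * w F = elC ℤ F := mul_w ..
theorem w_C : w F * elC ℤ F = elC ℤ F := w_mul ..
theorem Dp_w : elDp ℤ F * w F = elEp ℤ F := mul_w ..
theorem Dm_w : elDm ℤ F * w F = elEm ℤ F := mul_w ..
theorem Ep_w : elEp ℤ F * w F = elDp ℤ F := mul_w ..
theorem Em_w : elEm ℤ F * w F = elDm ℤ F := mul_w ..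
theorem w_Dp : w F * elDp ℤ F = elEm ℤ F := w_mul ..
theorem w_Dm : w F * elDm ℤ F = elEp ℤ F := w_mul ..
theorem w_Em : w F * elEm ℤ F = elDp ℤ F := w_mul ..

theorem Dm_conj : elDm ℤ F = w F * elDp ℤ F * w F := by rw [w_Dp, Em_w]

theorem A_Dp : elA ℤ F * elDp ℤ F = (qq - 1) • elDp ℤ F := by
  rw [elDp_eq, ← mul_assoc, A_A, smul_mul_assoc]
theorem Dp_A : elDp ℤ F * elA ℤ F = (qq - 1) • elDp ℤ F := by
  rw [elDp_eq', mul_assoc, A_A, mul_smul_comm]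
theorem A_Dm : elA ℤ F * elDm ℤ F = (qq - 1) • elDm ℤ F := by
  rw [elDm_eq, ← mul_assoc, A_A, smul_mul_assoc]
theorem Dm_A : elDm ℤ F * elA ℤ F = (qq - 1) • elDm ℤ F := by
  rw [Dm_conj, mul_assoc, w_A, ← A_w, ← mul_assoc, mul_assoc (w F), Dp_A, mul_smul_comm,
    smul_mul_assoc]

theorem Dp_Dp : elDp ℤ F * elDp ℤ F = (qq - 1) ^ 2 • elA ℤ F + ((qq - 1) * (qq - 2)) • elDp ℤ F := by
  calc elDp ℤ F * elDp ℤ F = elDp ℤ F * elA ℤ F * u F := by rw [mul_assoc, ← elDp_eq]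
    _ = (qq - 1) • (elA ℤ F * (u F * u F)) := by
      rw [Dp_A, elDp_eq, smul_mul_assoc, mul_assoc]
    _ = _ := by
      rw [u_u, mul_add, mul_smul_comm, mul_smul_comm, mul_one, ← elDp_eq]
      module

theorem Dm_Dm : elDm ℤ F * elDm ℤ F = (qq - 1) ^ 2 • elA ℤ F + ((qq - 1) * (qq - 2)) • elDm ℤ F := by
  calc elDm ℤ F * elDm ℤ F = elDm ℤ F * w F * elDp ℤ F * w F := by
        nth_rw 2 [Dm_conj]; simp only [mul_assoc]
    _ = w F * (elDp ℤ F * elDp ℤ F) * w F := by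
      rw [Dm_w, ← w_Dp]; simp only [mul_assoc]
    _ = _ := by
      rw [Dp_Dp, mul_add, add_mul]
      simp only [mul_smul_comm, smul_mul_assoc]
      rw [w_A, B_w, w_Dp, Em_w]

theorem Dp_Dm : elDp ℤ F * elDm ℤ F = (qq - 1) • (elC ℤ F + elEm ℤ F) := by
  rw [elDm_eq, ← mul_assoc, Dp_A, smul_mul_assoc, elDp_eq, A_u_v]

theorem Dm_Dp : elDm ℤ F * elDp ℤ F = (qq - 1) • (elC ℤ F + elEp ℤ F) := by
  calc elDm ℤ F * elDp ℤ F = elDm ℤ F * elEp ℤ F * w F := by rw [mul_assoc, Ep_w]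
    _ = w F * (elDp ℤ F * elDm ℤ F) * w F := by
      rw [← w_Dm, ← mul_assoc, Dm_w, ← w_Dp]; simp only [mul_assoc]
    _ = _ := by
      rw [Dp_Dm, mul_smul_comm, smul_mul_assoc, mul_add, add_mul, w_C, C_w, w_Em, Dp_w]

theorem S_Dp : S F * elDp ℤ F = (qq - 1) ^ 2 • S F := by
  rw [elDp_eq, ← mul_assoc, S_A, smul_mul_assoc, S_u]; module

theorem S_Dm : S F * elDm ℤ F = (qq - 1) ^ 2 • S F := by
  rw [Dm_conj, ← mul_assoc, ← mul_assoc, S_w, S_Dp, smul_mul_assoc, S_w]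

theorem S_C : ∃ n : ℤ, S F * elC ℤ F = n • S F := by
  unfold elC suppClass
  rw [Finset.mul_sum]
  simp only [S_mul_of, Finset.sum_const]
  exact ⟨_, (natCast_zsmul _ _).symm⟩

/-- Abstract ring computation. -/
theorem abstract_products {R : Type*} [Ring R] (q n : ℤ) (A w D S B E C : R)
    (hB : B = A * w) (hE : E = D * w) (hC : S = A + B + C + D + E)
    (cAw : w * A = A * w) (cDw : w * D = D * w) (cDA : D * A = A * D)
    (cS : ∀ x, S * x = x * S)
    (hBw : B * w = A) (hEw : E * w = D) (hCw : C * w = C)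
    (hAA : A * A = (q - 1) • A) (hAD : A * D = (q - 1) • D)
    (hDD : D * D = (2 * (q - 1) ^ 2) • A + ((q - 1) * (q - 2)) • D + (q - 1) • (2 • C + E))
    (hSA : S * A = (q - 1) • S) (hSw : S * w = S) (hSD : S * D = (2 * (q - 1) ^ 2) • S)
    (hSC : S * C = n • S) :
    (∀ X ∈ ({A, B, C, D, E} : Set R), ∀ Y ∈ ({A, B, C, D, E} : Set R), X * Y = Y * X) ∧
    C * (D + E) = (4 * (q - 1) * (q - 3)) • C + (2 * (q - 1) * (q - 2)) • (D + E) ∧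
    (D + E) * C = (4 * (q - 1) * (q - 3)) • C + (2 * (q - 1) * (q - 2)) • (D + E) ∧
    (D + E) * (D + E) = (4 * (q - 1) ^ 2) • (A + B) + (8 * (q - 1)) • C +
      (2 * (q - 1) ^ 2) • (D + E) ∧
    (∀ x ∈ Submodule.span ℤ ({A + B, C, D + E} : Set R),
      ∀ y ∈ Submodule.span ℤ ({A + B, C, D + E} : Set R),
        x * y ∈ Submodule.span ℤ ({A + B, C, D + E} : Set R) ∧ x * y = y * x) := by
  have hC' : C = S - A - B - D - E := by rw [hC]; abel
  have key : ∀ Z : R, Commute Z A → Commute Z w → Commute Z D →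
      ∀ Y ∈ ({A, B, C, D, E} : Set R), Commute Z Y := by
    intro Z h1 h2 h3 Y hY
    have hb : Commute Z B := hB ▸ h1.mul_right h2
    have he : Commute Z E := hE ▸ h3.mul_right h2
    have hs : Commute Z S := (cS Z).symm
    have hc : Commute Z C := by
      rw [hC']
      exact (((hs.sub_right h1).sub_right hb).sub_right h3).sub_right he
    rcases hY with rfl | rfl | rfl | rfl | rfl <;> assumption
  have kA := key A rfl cAw.symm cDA.symm
  have kw := key w cAw rfl cDw
  have kD := key D cDA cDw.symm rfl
  have comm : ∀ X ∈ ({A, B, C, D, E} : Set R), ∀ Y ∈ ({A, B, C, D, E} : Set R), X * Y = Y * X := by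
    intro X hX Y hY
    exact key X (kA X hX).symm (kw X hX).symm (kD X hX).symm Y hY
  have cBA : B * A = A * B := comm _ (by simp) _ (by simp)
  have cEA : E * A = A * E := comm _ (by simp) _ (by simp)
  have cDB : D * B = B * D := comm _ (by simp) _ (by simp)
  have cEB : E * B = B * E := comm _ (by simp) _ (by simp)
  have cED : E * D = D * E := comm _ (by simp) _ (by simp)
  have cBw : w * B = B * w := kw _ (by simp)
  have cEw : w * E = E * w := kw _ (by simp)
  have hAB : A * B = (q - 1) • B := by rw [hB, ← mul_assoc, hAA, smul_mul_assoc]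
  have hAE : A * E = (q - 1) • E := by rw [hE, ← mul_assoc, hAD, smul_mul_assoc]
  have hBB : B * B = (q - 1) • A := by
    nth_rw 1 [hB]; rw [mul_assoc, cBw, hBw, hAA]
  have hBD : B * D = (q - 1) • E := by
    rw [hB, mul_assoc, cDw, ← mul_assoc, hAD, hE, smul_mul_assoc]
  have hBE : B * E = (q - 1) • D := by
    rw [hB, mul_assoc, cEw, hEw, hAD]
  have hEE : E * E = D * D := by
    nth_rw 1 [hE]; rw [mul_assoc, cEw, hEw]
  have hDE : D * E = (2 * (q - 1) ^ 2) • B + ((q - 1) * (q - 2)) • E +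
      (q - 1) • (2 • C + D) := by
    rw [hE, ← mul_assoc, hDD]
    simp only [add_mul, smul_mul_assoc, hCw, hEw, ← hB, ← hE]
  have hSB : S * B = (q - 1) • S := by rw [hB, ← mul_assoc, hSA, smul_mul_assoc, hSw]
  have hSE : S * E = (2 * (q - 1) ^ 2) • S := by rw [hE, ← mul_assoc, hSD, smul_mul_assoc, hSw]
  have II : (A + B) * (A + B) = (2 * (q - 1)) • (A + B) := by
    simp only [add_mul, mul_add, cBA, hAA, hAB, hBB]; module
  have IF : (A + B) * (D + E) = (2 * (q - 1)) • (D + E) := by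
    simp only [add_mul, mul_add, hAD, hAE, hBD, hBE]; module
  have FF : (D + E) * (D + E) = (4 * (q - 1) ^ 2) • (A + B) + (8 * (q - 1)) • C +
      (2 * (q - 1) ^ 2) • (D + E) := by
    simp only [add_mul, mul_add, cED, hEE, hDE, hDD]; module
  have SI : S * (A + B) = (2 * (q - 1)) • S := by rw [mul_add, hSA, hSB]; module
  have SF : S * (D + E) = (4 * (q - 1) ^ 2) • S := by rw [mul_add, hSD, hSE]; module
  have hC2 : C = S - (A + B) - (D + E) := by rw [hC]; abel
  have cCF : (D + E) * C = C * (D + E) := by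
    rw [add_mul, mul_add, comm C (by simp) D (by simp), comm C (by simp) E (by simp)]
  have cCI : C * (A + B) = (A + B) * C := by
    rw [add_mul, mul_add, comm C (by simp) A (by simp), comm C (by simp) B (by simp)]
  have cFI : (D + E) * (A + B) = (A + B) * (D + E) := by
    simp only [add_mul, mul_add, cDA, cDB, cEA, cEB]; abel
  have CF : C * (D + E) = (4 * (q - 1) * (q - 3)) • C + (2 * (q - 1) * (q - 2)) • (D + E) := by
    nth_rw 1 [hC2]
    rw [sub_mul, sub_mul, SF, IF, FF, hC]
    module
  have IC : (A + B) * C = (2 * (q - 1)) • C := by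
    rw [← cCI]
    nth_rw 1 [hC2]
    rw [sub_mul, sub_mul, SI, II, cFI, IF, hC]
    module
  have CC : C * C = n • (A + B + C + (D + E)) - (2 * (q - 1)) • C -
      ((4 * (q - 1) * (q - 3)) • C + (2 * (q - 1) * (q - 2)) • (D + E)) := by
    nth_rw 1 [hC2]
    rw [sub_mul, sub_mul, hSC, IC, cCF, CF, hC]
    module
  refine ⟨comm, CF, cCF.trans CF, FF, ?_⟩
  generalize A + B = I at *
  generalize D + E = F' at *
  intro x hx y hy
  rw [Submodule.mem_span_triple] at hx hy ⊢
  obtain ⟨a, b, c, rfl⟩ := hx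
  obtain ⟨a', b', c', rfl⟩ := hy
  simp only [add_mul, mul_add, smul_mul_assoc, mul_smul_comm, cCF, cCI, cFI, II, IF, IC, CC, CF, FF]
  constructor
  · refine ⟨a * a' * (2 * (q - 1)) + b * b' * n + c * c' * (4 * (q - 1) ^ 2),
      (a * b' + a' * b) * (2 * (q - 1)) + (b * c' + b' * c) * (4 * (q - 1) * (q - 3)) +
      b * b' * (n - 2 * (q - 1) - 4 * (q - 1) * (q - 3)) + c * c' * (8 * (q - 1)),
      (a * c' + a' * c) * (2 * (q - 1)) + (b * c' + b' * c) * (2 * (q - 1) * (q - 2)) +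
      b * b' * (n - 2 * (q - 1) * (q - 2)) + c * c' * (2 * (q - 1) ^ 2), ?_⟩
    module
  · module

end ICFproof

theorem commutative_subring_ICF (F : Type*) [Field F] [Fintype F] [DecidableEq F]
    (hq : 2 < Fintype.card F) (q : ℤ) (hqc : q = Fintype.card F)
    (I D E F' : MonoidAlgebra ℤ (Matrix.SpecialLinearGroup (Fin 2) F))
    (hI : I = elA ℤ F + elB ℤ F)
    (hD : D = elDp ℤ F + elDm ℤ F)
    (hE : E = elEp ℤ F + elEm ℤ F)
    (hF' : F' = D + E) :
    (∀ X ∈ ({elA ℤ F, elB ℤ F, elC ℤ F, D, E} : Set (MonoidAlgebra ℤ (Matrix.SpecialLinearGroup (Fin 2) F))),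
      ∀ Y ∈ ({elA ℤ F, elB ℤ F, elC ℤ F, D, E} : Set (MonoidAlgebra ℤ (Matrix.SpecialLinearGroup (Fin 2) F))),
        X * Y = Y * X) ∧
    elC ℤ F * F' = (4 * (q - 1) * (q - 3)) • elC ℤ F + (2 * (q - 1) * (q - 2)) • F' ∧
    F' * elC ℤ F = (4 * (q - 1) * (q - 3)) • elC ℤ F + (2 * (q - 1) * (q - 2)) • F' ∧
    F' * F' = (4 * (q - 1) ^ 2) • I + (8 * (q - 1)) • elC ℤ F + (2 * (q - 1) ^ 2) • F' ∧
    (∀ x ∈ Submodule.span ℤ ({I, elC ℤ F, F'} : Set (MonoidAlgebra ℤ (Matrix.SpecialLinearGroup (Fin 2) F))),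
      ∀ y ∈ Submodule.span ℤ ({I, elC ℤ F, F'} : Set (MonoidAlgebra ℤ (Matrix.SpecialLinearGroup (Fin 2) F))),
        x * y ∈ Submodule.span ℤ ({I, elC ℤ F, F'} : Set (MonoidAlgebra ℤ (Matrix.SpecialLinearGroup (Fin 2) F))) ∧ x * y = y * x) := by
  subst hI hF' hD hE hqc
  obtain ⟨n, hn⟩ := ICFproof.S_C (F := F)
  refine ICFproof.abstract_products (Fintype.card F : ℤ) n (elA ℤ F) (ICFproof.w F)
    (elDp ℤ F + elDm ℤ F) (ICFproof.S F) (elB ℤ F) (elEp ℤ F + elEm ℤ F) (elC ℤ F)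
    ICFproof.A_w.symm ?_ ?_ ?_ ?_ ?_ ICFproof.S_comm ICFproof.B_w ?_ ICFproof.C_w
    ICFproof.A_A ?_ ?_ ICFproof.S_A ICFproof.S_w ?_ hn
  · rw [add_mul, ICFproof.Dp_w, ICFproof.Dm_w]
  · rw [ICFproof.S_eq]; abel
  · rw [ICFproof.w_A, ICFproof.A_w]
  · rw [add_mul, mul_add, ICFproof.Dp_w, ICFproof.Dm_w, ICFproof.w_Dp, ICFproof.w_Dm, add_comm]
  · rw [add_mul, mul_add, ICFproof.Dp_A, ICFproof.Dm_A, ICFproof.A_Dp, ICFproof.A_Dm]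
  · rw [add_mul, ICFproof.Ep_w, ICFproof.Em_w]
  · rw [mul_add, ICFproof.A_Dp, ICFproof.A_Dm, smul_add]
  · rw [add_mul, mul_add, mul_add, ICFproof.Dp_Dp, ICFproof.Dp_Dm, ICFproof.Dm_Dp, ICFproof.Dm_Dm]
    module
  · rw [mul_add, ICFproof.S_Dp, ICFproof.S_Dm]
    module
end
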